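/- arXiv:1812.04285 — 6 statements merged into one kernel-verified Lean document; each statement's English description precedes it below -/
import Mathlib

section
/- Let (X,Φ) be a regular topological flow and let S be a weakly extendable cross-section of time η > 0. Then for every 0 < ζ ≤ η one has Int(S_η) ∩ S = Int(S_ζ) ∩ S; consequently the flow interior Int^Φ(S) := Int(S_ζ) ∩ S does not depend on the choice of ζ ∈ (0,η]. -/
open Set Filter Topology MeasureTheory

namespace FlowPaper

variable {X : Type*} [MetricSpace X]

/-- The flow `Φ` is regular when no point is fixed by the whole flow. -/
def Regular (Φ : Flow ℝ X) : Prop := ∀ x : X, ∃ t : ℝ, Φ t x ≠ x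

/-- `φ_I(E) = {φ_t x : t ∈ I, x ∈ E}`. -/
def flowSet (Φ : Flow ℝ X) (I : Set ℝ) (E : Set X) : Set X := ⋃ t ∈ I, Φ t '' E

/-- The `ζ`-cylinder `S_ζ = φ_{[-ζ,ζ]}(S)`. -/
def cyl (Φ : Flow ℝ X) (S : Set X) (ζ : ℝ) : Set X := flowSet Φ (Icc (-ζ) ζ) S

/-- `S` is a cross-section of time `η` if `Φ` is injective on `S × [-η,η]`. -/
def IsCrossSection (Φ : Flow ℝ X) (S : Set X) (η : ℝ) : Prop :=
  Set.InjOn (fun p : X × ℝ => Φ p.2 p.1) (S ×ˢ Icc (-η) η)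

/-- Weakly extendable cross-section of time `η`. -/
def IsWec (Φ : Flow ℝ X) (S : Set X) (η : ℝ) : Prop :=
  IsCrossSection Φ S η ∧ IsCrossSection Φ (closure S) η

/-- The flow interior `Int^Φ(S) = Int(S_η) ∩ S`. -/
def flowInterior (Φ : Flow ℝ X) (S : Set X) (η : ℝ) : Set X := interior (cyl Φ S η) ∩ S

/-- The flow boundary `∂^Φ S = closure S \ Int^Φ(S)`. -/
def flowBoundary (Φ : Flow ℝ X) (S : Set X) (η : ℝ) : Set X := closure S \ flowInterior Φ S η

/-- `∂^Φ S_ζ = φ_{[-ζ,ζ]}(∂^Φ S)`. -/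
def flowBoundaryCyl (Φ : Flow ℝ X) (S : Set X) (η ζ : ℝ) : Set X := cyl Φ (flowBoundary Φ S η) ζ

/-- A cross-section is global when some cylinder covers `X`. -/
def IsGlobal (Φ : Flow ℝ X) (S : Set X) : Prop := ∃ ξ > 0, cyl Φ S ξ = univ

/-- First return time `t_S(x) = inf {t > 0 : φ_t x ∈ S}`. -/
noncomputable def returnTime (Φ : Flow ℝ X) (S : Set X) (x : X) : ℝ :=
  sInf {t : ℝ | 0 < t ∧ Φ t x ∈ S}

/-- First return map `T_S(x) = φ_{t_S(x)}(x)`. -/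
noncomputable def returnMap (Φ : Flow ℝ X) (S : Set X) (x : X) : X := Φ (returnTime Φ S x) x

/-- A measure is `Φ`-invariant when it is invariant under every time `t`-map. -/
def FlowInvariant [MeasurableSpace X] (Φ : Flow ℝ X) (μ : Measure X) : Prop :=
  ∀ t : ℝ, Measure.map (Φ t) μ = μ

/-- A w.e.c. `S` of time `η` has small flow boundary when `∂^Φ S_η` is a null set. -/
def HasSmallFlowBoundary [MeasurableSpace X] (Φ : Flow ℝ X) (S : Set X) (η : ℝ) : Prop :=
  ∀ μ : Measure X, IsProbabilityMeasure μ → FlowInvariant Φ μ → μ (flowBoundaryCyl Φ S η η) = 0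

/-- The small flow boundary property of a flow. -/
def SmallFlowBoundaryProperty [MeasurableSpace X] (Φ : Flow ℝ X) : Prop :=
  ∀ x : X, ∀ S' : Set X, ∀ η : ℝ, 0 < η → IsWec Φ S' η → x ∈ flowInterior Φ S' η →
    ∃ S ⊆ S', x ∈ flowInterior Φ S η ∧ IsWec Φ S η ∧ HasSmallFlowBoundary Φ S η

/-- The frontier of `A` with respect to the topology induced on `B`. -/
def frontierIn (B A : Set X) : Set X :=
  Subtype.val '' (frontier (Subtype.val ⁻¹' A : Set B))

theorem mem_cyl {X : Type*} [MetricSpace X] {Φ : Flow ℝ X} {S : Set X} {ζ : ℝ} {y : X} :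
    y ∈ cyl Φ S ζ ↔ ∃ t ∈ Icc (-ζ) ζ, ∃ x ∈ S, Φ t x = y := by
  simp only [cyl, flowSet, mem_iUnion, mem_image, exists_prop]

theorem cyl_mono {X : Type*} [MetricSpace X] (Φ : Flow ℝ X) (S : Set X) {ζ η : ℝ} (h : ζ ≤ η) :
    cyl Φ S ζ ⊆ cyl Φ S η :=
  biUnion_subset_biUnion_left (Icc_subset_Icc (neg_le_neg h) h)

/-- Flowing a compact set along a compact set of times gives a compact set. -/
theorem isCompact_image_flow {X : Type*} [MetricSpace X] (Φ : Flow ℝ X) {K : Set X} {I : Set ℝ}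
    (hK : IsCompact K) (hI : IsCompact I) :
    IsCompact ((fun p : X × ℝ => Φ p.2 p.1) '' (K ×ˢ I)) :=
  (hK.prod hI).image (Φ.continuous continuous_snd continuous_fst)

/-- the flow interior of a w.e.c. does not depend on the chosen time `ζ ∈ (0,η]`. -/
theorem flowInterior_indep_of_time {X : Type*} [MetricSpace X] [CompactSpace X]
    (Φ : Flow ℝ X) (hreg : Regular Φ) (S : Set X) (η : ℝ) (hη : 0 < η)
    (hS : IsWec Φ S η) :
    ∀ ζ : ℝ, 0 < ζ → ζ ≤ η → interior (cyl Φ S η) ∩ S = interior (cyl Φ S ζ) ∩ S := by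
  intro ζ hζ hζη
  refine Subset.antisymm ?_ (inter_subset_inter_left _ (interior_mono (cyl_mono Φ S hζη)))
  rintro x ⟨hx, hxS⟩
  refine ⟨?_, hxS⟩
  have hI : IsCompact (Icc (-η) η ∩ {t : ℝ | ζ ≤ |t|}) :=
    isCompact_Icc.inter_right (isClosed_le continuous_const continuous_abs)
  have hA := (isCompact_image_flow Φ (isClosed_closure (s := S)).isCompact hI).isClosed
  refine mem_interior.2 ⟨_, ?_, isOpen_interior.inter hA.isOpen_compl, hx, ?_⟩
  · rintro y ⟨hy, hyA⟩
    obtain ⟨t, ht, z, hz, rfl⟩ := mem_cyl.1 (interior_subset hy)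
    refine mem_cyl.2 ⟨t, abs_le.1 (le_of_lt ?_), z, hz, rfl⟩
    by_contra! hle
    exact hyA ⟨(z, t), ⟨subset_closure hz, ht, hle⟩, rfl⟩
  · rintro ⟨⟨z, t⟩, ⟨hz, ht, hle⟩, hzt⟩
    have hzero : ((z, t) : X × ℝ) = (x, 0) :=
      hS.2 ⟨hz, ht⟩ ⟨subset_closure hxS, neg_nonpos.2 hη.le, hη.le⟩
        (hzt.trans (Φ.map_zero_apply x).symm)
    obtain ⟨rfl, rfl⟩ := Prod.mk.inj hzero
    exact absurd hle (by simpa using hζ)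

end FlowPaper
end

section
/- Let (X,Φ) be a regular topological flow and let S be a closed cross-section of time η > 0. Then: (1) the cylinder S_η is a closed subset of X, and consequently its topological boundary ∂S_η, and a fortiori ∂^Φ S_η, has empty interior in X; (2) Int^Φ(∂^Φ S) = ∅; (3) if S is moreover global, then the closure of Int^Φ(S) is also a global closed cross-section. -/
open Set Filter Topology MeasureTheory

namespace FlowPaper

variable {X : Type*} [MetricSpace X]

theorem mem_flowSet {Φ : Flow ℝ X} {I : Set ℝ} {E : Set X} {x : X} :
    x ∈ flowSet Φ I E ↔ ∃ t ∈ I, ∃ y ∈ E, Φ t y = x := by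
  simp [flowSet]

theorem isCompact_flowSet (Φ : Flow ℝ X) {I : Set ℝ} {E : Set X} (hI : IsCompact I)
    (hE : IsCompact E) : IsCompact (flowSet Φ I E) := by
  have h : flowSet Φ I E = (fun p : ℝ × X => Φ p.1 p.2) '' (I ×ˢ E) := by
    ext x
    simp [flowSet]
  rw [h]
  exact (hI.prod hE).image (Φ.continuous continuous_fst continuous_snd)

/-- If some point on the orbit segment through `x ∈ S` lies in the interior of the cylinder of a
compact cross-section `S`, then so does `x`. -/
theorem IsCrossSection.mem_interior_cyl {Φ : Flow ℝ X} {S : Set X} {η t : ℝ} {x : X}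
    (hS : IsCrossSection Φ S η) (hη : 0 < η) (hc : IsCompact S) (hx : x ∈ S)
    (ht : t ∈ Icc (-η) η) (h : Φ t x ∈ interior (cyl Φ S η)) : x ∈ interior (cyl Φ S η) := by
  have hK : IsCompact (flowSet Φ (Icc (-η - t) (η - t) \ Ioo (-η) η) S) :=
    isCompact_flowSet Φ (isCompact_Icc.diff isOpen_Ioo) hc
  have hxK : x ∉ flowSet Φ (Icc (-η - t) (η - t) \ Ioo (-η) η) S := by
    rw [mem_flowSet]
    rintro ⟨s, ⟨hs, hs'⟩, z, hz, rfl⟩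
    have hinj := @hS (Φ s z, t) ⟨hx, ht⟩ (z, t + s)
      ⟨hz, by constructor <;> linarith [hs.1, hs.2]⟩ (Φ.map_add t s z).symm
    have hs0 : s = 0 := by linarith [congrArg Prod.snd hinj]
    exact hs' ⟨by linarith, by linarith⟩
  have hU : IsOpen (Φ t ⁻¹' interior (cyl Φ S η)) :=
    isOpen_interior.preimage (Φ.continuous continuous_const continuous_id)
  refine mem_interior.2 ⟨_, ?_, hU.inter hK.isClosed.isOpen_compl, h, hxK⟩
  rintro y ⟨hy, hyK⟩
  obtain ⟨r, hr, z, hz, hrz⟩ := mem_flowSet.1 (interior_subset hy)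
  have hyz : Φ (r - t) z = y := by
    rw [sub_eq_neg_add, Φ.map_add, hrz, ← Φ.map_add, neg_add_cancel, Φ.map_zero_apply]
  have hs : r - t ∈ Ioo (-η) η := by
    by_contra hn
    exact hyK (mem_flowSet.2
      ⟨r - t, ⟨⟨by linarith [hr.1], by linarith [hr.2]⟩, hn⟩, z, hz, hyz⟩)
  exact mem_flowSet.2 ⟨r - t, Ioo_subset_Icc_self hs, z, hz, hyz⟩

theorem flowBoundary_eq_of_isClosed {Φ : Flow ℝ X} {S : Set X} {η : ℝ} (hS : IsClosed S) :
    flowBoundary Φ S η = S \ interior (cyl Φ S η) := by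
  rw [flowBoundary, flowInterior, hS.closure_eq, sdiff_inter_self_eq_sdiff]

theorem IsCrossSection.flowBoundaryCyl_subset_frontier {Φ : Flow ℝ X} {S : Set X} {η : ℝ}
    (hS : IsCrossSection Φ S η) (hη : 0 < η) (hc : IsCompact S) :
    flowBoundaryCyl Φ S η η ⊆ frontier (cyl Φ S η) := by
  intro y hy
  rw [flowBoundaryCyl, flowBoundary_eq_of_isClosed hc.isClosed] at hy
  obtain ⟨t, ht, x, hx, rfl⟩ := mem_flowSet.1 hy
  exact ⟨subset_closure (mem_flowSet.2 ⟨t, ht, x, hx.1, rfl⟩),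
    fun h => hx.2 (hS.mem_interior_cyl hη hc hx.1 ht h)⟩

/-- If a closed cylinder has empty interior, then the points whose orbit avoids its base are
dense. -/
theorem dense_orbit_avoiding [CompactSpace X] (Φ : Flow ℝ X) {B : Set X} {η : ℝ} (hη : 0 < η)
    (hB : IsClosed (cyl Φ B η)) (hint : interior (cyl Φ B η) = ∅) :
    Dense {x | ∀ t : ℝ, Φ t x ∉ B} := by
  have hd : Dense (⋂ n : ℤ, Φ.toHomeomorph (n * η) ⁻¹' (cyl Φ B η)ᶜ) :=
    dense_iInter_of_isOpen
      (fun n => hB.isOpen_compl.preimage (Φ.toHomeomorph (n * η)).continuous)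
      (fun n => (interior_eq_empty_iff_dense_compl.1 hint).preimage
        (Φ.toHomeomorph (n * η)).isOpenMap)
  refine hd.mono fun x hx t hB' => ?_
  refine mem_iInter.1 hx ⌊t / η⌋ (mem_flowSet.2 ⟨⌊t / η⌋ * η - t, ?_, Φ t x, hB', ?_⟩)
  · have h₁ : (⌊t / η⌋ : ℝ) * η ≤ t := (le_div_iff₀ hη).1 (Int.floor_le _)
    have h₂ : t < (⌊t / η⌋ + 1) * η := (div_lt_iff₀ hη).1 (Int.lt_floor_add_one _)
    constructor <;> linarith
  · rw [← Φ.map_add, sub_add_cancel]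
    rfl

theorem IsGlobal.closure_flowInterior [CompactSpace X] {Φ : Flow ℝ X} {S : Set X}
    {η : ℝ} (hg : IsGlobal Φ S) (hη : 0 < η) (hcl : IsClosed S)
    (hint : interior (flowBoundaryCyl Φ S η η) = ∅) :
    IsGlobal Φ (closure (flowInterior Φ S η)) := by
  obtain ⟨ξ, hξ, hcov⟩ := hg
  refine ⟨ξ, hξ, ?_⟩
  have hbd : IsClosed (flowBoundary Φ S η) := by
    rw [flowBoundary_eq_of_isClosed hcl]
    exact hcl.sdiff isOpen_interior
  have hclosed : IsClosed (flowBoundaryCyl Φ S η η) :=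
    (isCompact_flowSet Φ isCompact_Icc hbd.isCompact).isClosed
  have hd := dense_orbit_avoiding Φ hη hclosed hint
  have hcyl : IsClosed (cyl Φ (closure (flowInterior Φ S η)) ξ) :=
    (isCompact_flowSet Φ isCompact_Icc isClosed_closure.isCompact).isClosed
  rw [← hcyl.closure_eq]
  refine (hd.mono fun x hx => ?_).closure_eq
  obtain ⟨t, ht, z, hz, rfl⟩ := mem_flowSet.1 (hcov.symm ▸ mem_univ x : x ∈ cyl Φ S ξ)
  refine mem_flowSet.2 ⟨t, ht, z, subset_closure ?_, rfl⟩
  by_contra hn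
  apply hx (-t)
  rw [← Φ.map_add, neg_add_cancel, Φ.map_zero_apply]
  exact ⟨subset_closure hz, hn⟩

/-- properties of closed cross-sections: the cylinder is closed with boundary of
empty interior, the flow interior of the flow boundary is empty, and for a global closed
cross-section the closure of its flow interior is again a global closed cross-section. -/
theorem closed_crossSection_properties {X : Type*} [MetricSpace X] [CompactSpace X]
    (Φ : Flow ℝ X) (hreg : Regular Φ) (S : Set X) (η : ℝ) (hη : 0 < η)
    (hcl : IsClosed S) (hS : IsCrossSection Φ S η) :
    IsClosed (cyl Φ S η) ∧
    interior (frontier (cyl Φ S η)) = ∅ ∧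
    interior (flowBoundaryCyl Φ S η η) = ∅ ∧
    flowInterior Φ (flowBoundary Φ S η) η = ∅ ∧
    (IsGlobal Φ S →
      IsClosed (closure (flowInterior Φ S η)) ∧
      IsCrossSection Φ (closure (flowInterior Φ S η)) η ∧
      IsGlobal Φ (closure (flowInterior Φ S η))) := by
  have hcyl : IsClosed (cyl Φ S η) :=
    (isCompact_flowSet Φ isCompact_Icc hcl.isCompact).isClosed
  have hint : interior (flowBoundaryCyl Φ S η η) = ∅ := by
    have h := interior_mono (hS.flowBoundaryCyl_subset_frontier hη hcl.isCompact)
    rwa [interior_frontier hcyl, subset_empty_iff] at h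
  refine ⟨hcyl, interior_frontier hcyl, hint, ?_, fun hg => ⟨isClosed_closure, ?_,
    hg.closure_flowInterior hη hcl hint⟩⟩
  · rw [flowInterior, ← flowBoundaryCyl, hint, empty_inter]
  · exact hS.mono (prod_mono_left (closure_minimal inter_subset_right hcl))

end FlowPaper
end

section
/- Let (X,Φ) be a regular topological flow and let S be a global closed cross-section of time η > 0 with φ_{[−ξ,ξ]}(S) = X for some ξ > 0. Then the first return time t_S is piecewise continuous: there exists a finite partition (C_k)_{1≤k≤K} of S into weakly extendable cross-sections such that t_S is uniformly continuous on each C_k; moreover the boundary of each C_k with respect to the topology induced on S has empty interior in S. -/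
open Set Filter Topology MeasureTheory

namespace FlowPaper

variable {X : Type*} [MetricSpace X]

/-- The points of `S` that return to `S` at some time in `J`. -/
def returnSet (Φ : Flow ℝ X) (S : Set X) (J : Set ℝ) : Set X := {x ∈ S | ∃ t ∈ J, Φ t x ∈ S}

lemma returnSet_mono (Φ : Flow ℝ X) (S : Set X) {J J' : Set ℝ} (h : J ⊆ J') :
    returnSet Φ S J ⊆ returnSet Φ S J' :=
  fun _ ⟨hx, t, ht, hxt⟩ => ⟨hx, t, h ht, hxt⟩

lemma isClosed_returnSet (Φ : Flow ℝ X) {S : Set X} {J : Set ℝ} (hS : IsCompact S)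
    (hJ : IsCompact J) : IsClosed (returnSet Φ S J) := by
  have hcont : Continuous fun p : X × ℝ => Φ p.2 p.1 :=
    Φ.continuous continuous_snd continuous_fst
  have hcomp : IsCompact ((S ×ˢ J) ∩ (fun p : X × ℝ => Φ p.2 p.1) ⁻¹' S) :=
    (hS.prod hJ).inter_right (hS.isClosed.preimage hcont)
  convert (hcomp.image continuous_fst).isClosed using 1
  ext x
  constructor
  · rintro ⟨hx, t, ht, hxt⟩
    exact ⟨(x, t), ⟨⟨hx, ht⟩, hxt⟩, rfl⟩
  · rintro ⟨⟨y, t⟩, ⟨⟨hy, ht⟩, hyt⟩, rfl⟩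
    exact ⟨hy, t, ht, hyt⟩

lemma IsCrossSection.mono {Φ : Flow ℝ X} {S T : Set X} {η : ℝ} (hS : IsCrossSection Φ S η)
    (h : T ⊆ S) : IsCrossSection Φ T η :=
  InjOn.mono (prod_mono h Subset.rfl) hS

/-- Two visits of an orbit to a cross-section of time `η` at most `2η` apart coincide. -/
lemma IsCrossSection.eq_of_abs_sub_le {Φ : Flow ℝ X} {S : Set X} {η : ℝ}
    (hS : IsCrossSection Φ S η) {x : X} {s t : ℝ} (hs : Φ s x ∈ S) (ht : Φ t x ∈ S)
    (hst : |t - s| ≤ 2 * η) : t = s := by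
  obtain ⟨h1, h2⟩ := abs_le.1 hst
  have key := @hS (Φ s x, (t - s) / 2) ⟨hs, by constructor <;> dsimp only <;> linarith⟩
    (Φ t x, (s - t) / 2) ⟨ht, by constructor <;> dsimp only <;> linarith⟩ (by
      simp only [← Φ.map_add]
      congr 1
      ring)
  have := (Prod.mk.inj key).2
  linarith

lemma IsCrossSection.two_mul_lt_of_return {Φ : Flow ℝ X} {S : Set X} {η : ℝ}
    (hS : IsCrossSection Φ S η) {x : X} {t : ℝ} (hx : x ∈ S) (ht : 0 < t) (hxt : Φ t x ∈ S) :
    2 * η < t := by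
  by_contra! h
  have := hS.eq_of_abs_sub_le (s := 0) (by simpa using hx) hxt (by
    rw [sub_zero, abs_of_pos ht]; exact h)
  linarith

lemma interior_frontier_sdiff_of_isClosed {Y : Type*} [TopologicalSpace Y] {A B : Set Y}
    (hA : IsClosed A) (hB : IsClosed B) : interior (frontier (A \ B)) = ∅ := by
  have hsub : frontier (A \ B) ⊆ frontier A ∪ frontier B := by
    intro y hy
    rcases frontier_inter_subset A Bᶜ (by rwa [← sdiff_eq]) with h | h
    · exact Or.inl h.1
    · exact Or.inr (by simpa using h.2)
  refine subset_empty_iff.1 ((interior_mono hsub).trans ?_)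
  rw [interior_union_isClosed_of_interior_empty isClosed_frontier (interior_frontier hB),
    interior_frontier hA]

/-- The points whose first return happens in `[a, b]` but not in `[η, a]`, for `b - a ≤ 2η`,
form a set on which the return time is uniformly continuous. -/
lemma uniformContinuousOn_returnTime {Φ : Flow ℝ X} {S : Set X} {η a b : ℝ} (hη : 0 < η)
    (hcomp : IsCompact S) (hS : IsCrossSection Φ S η) (ha : 0 < a) (hab : b - a ≤ 2 * η) :
    UniformContinuousOn (returnTime Φ S)
      (returnSet Φ S (Icc a b) \ returnSet Φ S (Icc η a)) := by
  have hex : ∀ x ∈ returnSet Φ S (Icc a b), ∃ t, t ∈ Icc a b ∧ Φ t x ∈ S := fun x hx => hx.2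
  choose! g hg hgS using hex
  have huniq : ∀ x ∈ returnSet Φ S (Icc a b), ∀ t ∈ Icc a b, Φ t x ∈ S → t = g x := by
    intro x hx t ht hxt
    have := hg x hx
    exact hS.eq_of_abs_sub_le (hgS x hx) hxt
      (abs_le.2 ⟨by linarith [ht.1, this.2], by linarith [ht.2, this.1]⟩)
  have hcont : ContinuousOn g (returnSet Φ S (Icc a b)) := by
    refine continuousOn_iff_isClosed.2 fun F hF =>
      ⟨_, isClosed_returnSet Φ hcomp (isCompact_Icc.inter_right hF : IsCompact (Icc a b ∩ F)), ?_⟩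
    ext x
    constructor
    · rintro ⟨hxF, hx⟩
      exact ⟨⟨hx.1, g x, ⟨hg x hx, hxF⟩, hgS x hx⟩, hx⟩
    · rintro ⟨⟨-, t, ⟨ht, htF⟩, hxt⟩, hx⟩
      refine ⟨?_, hx⟩
      rw [mem_preimage, ← huniq x hx t ht hxt]
      exact htF
  have hA : IsCompact (returnSet Φ S (Icc a b)) :=
    hcomp.of_isClosed_subset (isClosed_returnSet Φ hcomp isCompact_Icc) fun _ h => h.1
  refine ((hA.uniformContinuousOn_of_continuous hcont).mono sdiff_subset).congr ?_
  rintro x ⟨hx, hx'⟩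
  have hleast : IsLeast {t : ℝ | 0 < t ∧ Φ t x ∈ S} (g x) := by
    refine ⟨⟨ha.trans_le (hg x hx).1, hgS x hx⟩, ?_⟩
    rintro t ⟨ht, hxt⟩
    by_contra! hlt
    have h2 := hS.two_mul_lt_of_return hx.1 ht hxt
    rcases le_total t a with h | h
    · exact hx' ⟨hx.1, t, ⟨by linarith, h⟩, hxt⟩
    · exact hlt.ne (huniq x hx t ⟨h, hlt.le.trans (hg x hx).2⟩ hxt)
  exact hleast.csInf_eq.symm

lemma exists_return_of_cyl_eq_univ {Φ : Flow ℝ X} {S : Set X} {ξ : ℝ} (hξ : 0 < ξ)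
    (hglob : cyl Φ S ξ = univ) (x : X) : ∃ t, 0 < t ∧ t ≤ 3 * ξ ∧ Φ t x ∈ S := by
  have h : Φ (2 * ξ) x ∈ cyl Φ S ξ := hglob ▸ mem_univ _
  simp only [cyl, flowSet, mem_iUnion, mem_image] at h
  obtain ⟨s, hs, z, hz, hzx⟩ := h
  refine ⟨2 * ξ - s, by linarith [hs.2], by linarith [hs.1], ?_⟩
  have : Φ (2 * ξ - s) x = z := by
    rw [sub_eq_neg_add, Φ.map_add, ← hzx, ← Φ.map_add]
    simp
  rwa [this]

/-- the first return time of a global closed cross-section is piecewise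
(uniformly) continuous on a finite partition of `S` into w.e.c.'s whose boundaries in `S` have
empty interior in `S`. -/
theorem returnTime_piecewise_continuous {X : Type*} [MetricSpace X] [CompactSpace X]
    (Φ : Flow ℝ X) (hreg : Regular Φ) (S : Set X) (η ξ : ℝ) (hη : 0 < η) (hξ : 0 < ξ)
    (hcl : IsClosed S) (hS : IsCrossSection Φ S η) (hglob : cyl Φ S ξ = univ) :
    ∃ (K : ℕ) (C : Fin K → Set X),
      (∀ i j, i ≠ j → Disjoint (C i) (C j)) ∧
      (⋃ i, C i) = S ∧
      (∀ i, IsWec Φ (C i) η) ∧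
      (∀ i, UniformContinuousOn (returnTime Φ S) (C i)) ∧
      (∀ i, interior (frontier (Subtype.val ⁻¹' (C i) : Set S)) = (∅ : Set S)) := by
  have hcomp : IsCompact S := hcl.isCompact
  set C : ℕ → Set X := fun i =>
    returnSet Φ S (Icc ((i + 1) * η) ((i + 2) * η)) \ returnSet Φ S (Icc η ((i + 1) * η))
  have hCS : ∀ i, C i ⊆ S := fun i x hx => hx.1.1
  have hlt : ∀ i j, i < j → Disjoint (C i) (C j) := by
    intro i j hij
    refine disjoint_left.2 fun x hxi hxj => hxj.2 (returnSet_mono Φ S (Icc_subset_Icc ?_ ?_) hxi.1)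
    · nlinarith [(Nat.cast_nonneg i : (0 : ℝ) ≤ i)]
    · have : (i : ℝ) + 1 ≤ j := by exact_mod_cast hij
      nlinarith
  obtain ⟨N, hN⟩ := exists_nat_gt (3 * ξ / η)
  rw [div_lt_iff₀ hη] at hN
  refine ⟨N + 1, fun i => C i, ?_, ?_, fun i => ?_, fun i => ?_, fun i => ?_⟩
  · intro i j hij
    rcases lt_or_gt_of_ne hij with h | h
    · exact hlt i j h
    · exact (hlt j i h).symm
  · refine Subset.antisymm (iUnion_subset fun i => hCS i) fun x hx => ?_
    classical
    have hP : x ∈ returnSet Φ S (Icc η ((N + 2) * η)) := by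
      obtain ⟨t, ht0, ht, hxt⟩ := exists_return_of_cyl_eq_univ hξ hglob x
      have := hS.two_mul_lt_of_return hx ht0 hxt
      exact ⟨hx, t, ⟨by linarith, by linarith⟩, hxt⟩
    have hex : ∃ n : ℕ, x ∈ returnSet Φ S (Icc η ((n + 2) * η)) := ⟨N, hP⟩
    have hn := Nat.find_spec hex
    have hmin := fun m => @Nat.find_min _ _ hex m
    have hle := Nat.find_min' hex hP
    generalize Nat.find hex = n at hn hmin hle
    have hnot : x ∉ returnSet Φ S (Icc η ((n + 1) * η)) := by
      cases n with
      | zero =>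
        rintro ⟨-, t, ht, hxt⟩
        have := hS.two_mul_lt_of_return hx (hη.trans_le ht.1) hxt
        have := ht.2
        norm_num at this
        linarith
      | succ m =>
        have := hmin m m.lt_succ_self
        push_cast
        rwa [add_assoc, one_add_one_eq_two]
    refine mem_iUnion.2 ⟨⟨n, Nat.lt_succ_of_le hle⟩, ?_, hnot⟩
    obtain ⟨-, t, ht, hxt⟩ := hn
    refine ⟨hx, t, ⟨?_, ht.2⟩, hxt⟩
    by_contra! h
    exact hnot ⟨hx, t, ⟨ht.1, h.le⟩, hxt⟩
  · exact ⟨hS.mono (hCS i), hS.mono (closure_minimal (hCS i) hcl)⟩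
  · exact uniformContinuousOn_returnTime hη hcomp hS (by positivity) (by nlinarith)
  · exact interior_frontier_sdiff_of_isClosed
      ((isClosed_returnSet Φ hcomp isCompact_Icc).preimage continuous_subtype_val)
      ((isClosed_returnSet Φ hcomp isCompact_Icc).preimage continuous_subtype_val)

end FlowPaper
end

section
/- Let (X,Φ) be a regular topological flow and let 𝒮 be a complete family of closed cross-sections, with 𝔖 := ⋃_{S'∈𝒮} S'. Then for every S ∈ 𝒮 the first return time t_𝔖 is uniformly continuous on the set T_𝔖^{-1}(S). -/
open Set Filter Topology MeasureTheory

namespace FlowPaper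

variable {X : Type*} [MetricSpace X]

/-- Two points of the same orbit lying in a cross-section of time `η` and at flow distance
at most `2 * η` coincide in time. -/
theorem IsCrossSection.time_eq {Φ : Flow ℝ X} {S : Set X} {η : ℝ} (hS : IsCrossSection Φ S η)
    {x : X} {a b : ℝ} (ha : Φ a x ∈ S) (hb : Φ b x ∈ S) (hab : |a - b| ≤ 2 * η) : a = b := by
  obtain ⟨h₁, h₂⟩ := abs_le.mp hab
  have key : Φ ((b - a) / 2) (Φ a x) = Φ ((a - b) / 2) (Φ b x) := by
    rw [← Φ.map_add, ← Φ.map_add]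
    congr 1
    ring
  have h := @hS (Φ a x, (b - a) / 2) ⟨ha, by constructor <;> simp only <;> linarith⟩
    (Φ b x, (a - b) / 2) ⟨hb, by constructor <;> simp only <;> linarith⟩ key
  have := congrArg Prod.snd h
  simp only at this
  linarith

theorem returnTime_nonneg (Φ : Flow ℝ X) (S : Set X) (x : X) : 0 ≤ returnTime Φ S x :=
  Real.sInf_nonneg fun _ ht => ht.1.le

theorem returnTime_le_of_cyl_eq_univ {Φ : Flow ℝ X} {S : Set X} {ξ : ℝ}
    (hS : cyl Φ S ξ = univ) (x : X) : returnTime Φ S x ≤ 2 * ξ := by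
  refine le_of_forall_pos_le_add fun ε hε => ?_
  have hx : Φ (ξ + ε) x ∈ cyl Φ S ξ := hS ▸ mem_univ _
  simp only [cyl, flowSet, mem_iUnion, mem_image, mem_Icc] at hx
  obtain ⟨s, ⟨hs₁, hs₂⟩, y, hy, hyx⟩ := hx
  have hyx' : Φ (ξ + ε - s) x = y := by
    rw [show ξ + ε - s = -s + (ξ + ε) by ring, Φ.map_add, ← hyx, ← Φ.map_add]
    simp
  have hmem : ξ + ε - s ∈ {t : ℝ | 0 < t ∧ Φ t x ∈ S} := ⟨by linarith, by rwa [hyx']⟩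
  have hle : returnTime Φ S x ≤ ξ + ε - s := csInf_le ⟨0, fun _ ht => ht.1.le⟩ hmem
  linarith

theorem cyl_iUnion {ι : Sort*} (Φ : Flow ℝ X) (C : ι → Set X) (ζ : ℝ) :
    cyl Φ (⋃ i, C i) ζ = ⋃ i, cyl Φ (C i) ζ := by
  ext x
  simp only [cyl, flowSet, mem_iUnion, mem_image]
  tauto

/-- A real function whose graph lies in a compact set on which the second coordinate is
determined by the first one is uniformly continuous. -/
theorem uniformContinuousOn_of_graph_subset_isCompact {K : Set (X × ℝ)} (hK : IsCompact K)
    (hinj : InjOn Prod.fst K) {f : X → ℝ} {A : Set X} (hf : ∀ x ∈ A, (x, f x) ∈ K) :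
    UniformContinuousOn f A := by
  rw [Metric.uniformContinuousOn_iff]
  intro ε hε
  have hP : IsCompact ((K ×ˢ K) ∩ {p : (X × ℝ) × (X × ℝ) | ε ≤ dist p.1.2 p.2.2}) :=
    (hK.prod hK).inter_right (isClosed_le (by fun_prop) (by fun_prop))
  obtain ⟨δ, hδ, hle⟩ := hP.exists_forall_le' (f := fun p => dist p.1.1 p.2.1) (a := 0)
    (by fun_prop) (by
      rintro ⟨p, q⟩ ⟨⟨hp, hq⟩, hpq⟩
      refine dist_pos.mpr fun h => ?_
      obtain rfl : p = q := hinj hp hq h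
      simp only [mem_ofPred_eq, dist_self] at hpq
      linarith)
  refine ⟨δ, hδ, fun x hx y hy hxy => ?_⟩
  by_contra! h
  exact absurd (hle ((x, f x), (y, f y)) ⟨⟨hf x hx, hf y hy⟩, h⟩) (not_le.mpr hxy)

/-- for a complete family of closed cross-sections, the first return time of
`𝔖 = ⋃ S'` is uniformly continuous on each set `T_𝔖⁻¹(S)`, `S ∈ 𝒮`. -/
theorem returnTime_uniformContinuousOn_preimage {X : Type*} [MetricSpace X] [CompactSpace X]
    (Φ : Flow ℝ X) (hreg : Regular Φ) (N : ℕ) (C : Fin N → Set X) (η : ℝ) (hη : 0 < η)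
    (hcl : ∀ i, IsClosed (C i))
    (hcs : ∀ i, IsCrossSection Φ (C i) η)
    (hdisj : ∀ i j, i ≠ j → Disjoint (C i) (C j))
    (hcover : (⋃ i, cyl Φ (C i) (η / 2)) = univ)
    (i : Fin N) :
    UniformContinuousOn (returnTime Φ (⋃ j, C j))
      {x | x ∈ (⋃ j, C j) ∧ returnMap Φ (⋃ j, C j) x ∈ C i} := by
  have hK : IsCompact {p : X × ℝ | p.2 ∈ Icc 0 η ∧ Φ p.2 p.1 ∈ C i} := by
    refine (isCompact_univ.prod (isCompact_Icc (a := (0 : ℝ)) (b := η))).of_isClosed_subset ?_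
      fun p hp => ⟨mem_univ _, hp.1⟩
    exact (isClosed_Icc.preimage continuous_snd).inter
      ((hcl i).preimage (Φ.continuous continuous_snd continuous_fst))
  refine uniformContinuousOn_of_graph_subset_isCompact hK ?_ ?_
  · rintro ⟨x, a⟩ ⟨⟨ha₀, ha₁⟩, ha⟩ ⟨y, b⟩ ⟨⟨hb₀, hb₁⟩, hb⟩ hxy
    obtain rfl : x = y := hxy
    simp only at ha₀ ha₁ hb₀ hb₁
    exact Prod.ext rfl ((hcs i).time_eq ha hb (abs_le.mpr ⟨by linarith, by linarith⟩))
  · intro x hx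
    refine ⟨⟨returnTime_nonneg _ _ _, ?_⟩, hx.2⟩
    have h := returnTime_le_of_cyl_eq_univ ((cyl_iUnion Φ C _).trans hcover) x
    simp only
    linarith

end FlowPaper
end

section
/- Let (X,Φ) be a regular topological flow. A subset S ⊆ X is a Poincaré cross-section (i.e., a closed cross-section of some time η > 0 such that the flow map Φ : S × ℝ → X is a surjective local homeomorphism) if and only if S is a global closed cross-section with empty flow boundary ∂^Φ S = ∅. -/
open Set Filter Topology MeasureTheory

namespace FlowPaper

variable {X : Type*} [MetricSpace X]

theorem mem_cyl_iff {Φ : Flow ℝ X} {S : Set X} {ζ : ℝ} {x : X} :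
    x ∈ cyl Φ S ζ ↔ ∃ t ∈ Icc (-ζ) ζ, ∃ s ∈ S, Φ t s = x := by
  simp only [cyl, flowSet, mem_iUnion, mem_image, exists_prop]

theorem continuous_flowMap (Φ : Flow ℝ X) (S : Set X) :
    Continuous (fun p : S × ℝ => Φ p.2 (p.1 : X)) :=
  Φ.continuous continuous_snd (continuous_subtype_val.comp continuous_fst)

/-- For a closed cross-section in a compact space, the flow map `S × ℝ → X` is open at `(s, 0)`
whenever the cylinder of `S` is a neighbourhood of `s`. -/
theorem nhds_le_map_flowMap_zero [CompactSpace X] {Φ : Flow ℝ X}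
    {S : Set X} {η : ℝ} (hη : 0 < η) (hS : IsClosed S) (hcs : IsCrossSection Φ S η) (s : S)
    (hs : cyl Φ S η ∈ 𝓝 (s : X)) :
    𝓝 (s : X) ≤ map (fun p : S × ℝ => Φ p.2 (p.1 : X)) (𝓝 (s, 0)) := by
  have : CompactSpace S := isCompact_iff_compactSpace.mp hS.isCompact
  let ι : S × Icc (-η) η → S × ℝ := fun p => (p.1, p.2)
  have hι : Continuous ι := by fun_prop
  let G : S × Icc (-η) η → X := (fun p : S × ℝ => Φ p.2 (p.1 : X)) ∘ ι
  have hG : Continuous G := (continuous_flowMap Φ S).comp hι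
  have hinj : Function.Injective G := by
    rintro ⟨a, t⟩ ⟨b, u⟩ h
    have := hcs (x₁ := ((a : X), (t : ℝ))) (x₂ := ((b : X), (u : ℝ)))
      ⟨a.2, t.2⟩ ⟨b.2, u.2⟩ h
    simpa [Subtype.ext_iff] using this
  let z : S × Icc (-η) η := (s, ⟨0, by constructor <;> linarith⟩)
  have hz : G z = s := Φ.map_zero_apply _
  have hrange : range G ∈ 𝓝 (G z) := by
    rw [hz]
    filter_upwards [hs] with x hx
    obtain ⟨t, ht, a, ha, rfl⟩ := mem_cyl_iff.mp hx
    exact ⟨(⟨a, ha⟩, ⟨t, ht⟩), rfl⟩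
  calc 𝓝 (s : X) = map G (𝓝 z) := by
        rw [(hG.isClosedEmbedding hinj).isInducing.map_nhds_of_mem z hrange, hz]
    _ = map (fun p : S × ℝ => Φ p.2 (p.1 : X)) (map ι (𝓝 z)) := Filter.map_map.symm
    _ ≤ _ := map_mono (hι.tendsto z)

theorem isOpenMap_flowMap {Φ : Flow ℝ X} {S : Set X}
    (h : ∀ s : S, 𝓝 (s : X) ≤ map (fun p : S × ℝ => Φ p.2 (p.1 : X)) (𝓝 (s, 0))) :
    IsOpenMap (fun p : S × ℝ => Φ p.2 (p.1 : X)) := by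
  rw [isOpenMap_iff_nhds_le]
  rintro ⟨s, t⟩
  let σ : S × ℝ → S × ℝ := fun p => (p.1, t + p.2)
  have hσ : Continuous σ := by fun_prop
  have hσ0 : σ (s, 0) = (s, t) := by simp [σ]
  calc 𝓝 (Φ t (s : X)) = map (Φ t) (𝓝 (s : X)) := ((Φ.toHomeomorph t).map_nhds_eq s).symm
    _ ≤ map (Φ t) (map (fun p : S × ℝ => Φ p.2 (p.1 : X)) (𝓝 (s, 0))) := map_mono (h s)
    _ = map (fun p : S × ℝ => Φ p.2 (p.1 : X)) (map σ (𝓝 (s, 0))) := by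
        rw [Filter.map_map, Filter.map_map]
        congr 1
        ext p
        exact (Φ.map_add t p.2 p.1).symm
    _ ≤ _ := map_mono (hσ0 ▸ hσ.tendsto (s, 0))

theorem IsCrossSection.isLocalHomeomorph_flowMap {Φ : Flow ℝ X}
    {S : Set X} {η : ℝ} (hη : 0 < η) (hcs : IsCrossSection Φ S η)
    (hopen : IsOpenMap (fun p : S × ℝ => Φ p.2 (p.1 : X))) :
    IsLocalHomeomorph (fun p : S × ℝ => Φ p.2 (p.1 : X)) := by
  rw [isLocalHomeomorph_iff_isOpenEmbedding_restrict]
  rintro ⟨s, t⟩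
  have hU : IsOpen ((univ : Set S) ×ˢ Ioo (t - η) (t + η)) := isOpen_univ.prod isOpen_Ioo
  refine ⟨_, hU.mem_nhds ⟨mem_univ _, by constructor <;> linarith⟩,
    .of_continuous_injective_isOpenMap
      ((continuous_flowMap Φ S).comp continuous_subtype_val) ?_ (hopen.domRestrict hU)⟩
  rw [← injOn_iff_injective]
  rintro ⟨a, u⟩ ⟨-, hu₁, hu₂⟩ ⟨b, v⟩ ⟨-, hv₁, hv₂⟩ h
  dsimp only at hu₁ hu₂ hv₁ hv₂ h
  have heq : Φ (-t + u) (a : X) = Φ (-t + v) (b : X) := by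
    rw [Φ.map_add, Φ.map_add, h]
  have := hcs (x₁ := ((a : X), -t + u)) (x₂ := ((b : X), -t + v))
    ⟨a.2, by constructor <;> dsimp only <;> linarith⟩
    ⟨b.2, by constructor <;> dsimp only <;> linarith⟩ heq
  simpa [Subtype.ext_iff] using this

theorem isOpen_flow_image {Φ : Flow ℝ X} {S : Set X}
    (hopen : IsOpenMap (fun p : S × ℝ => Φ p.2 (p.1 : X))) (r : ℝ) :
    IsOpen ((fun p : S × ℝ => Φ p.2 (p.1 : X)) '' (univ ×ˢ Ioo (-r) r)) :=
  hopen _ (isOpen_univ.prod isOpen_Ioo)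

theorem flow_image_subset_cyl (Φ : Flow ℝ X) (S : Set X) (r : ℝ) :
    (fun p : S × ℝ => Φ p.2 (p.1 : X)) '' (univ ×ˢ Ioo (-r) r) ⊆ cyl Φ S r := by
  rintro _ ⟨⟨a, t⟩, ⟨-, ht⟩, rfl⟩
  exact mem_cyl_iff.mpr ⟨t, Ioo_subset_Icc_self ht, a, a.2, rfl⟩

theorem flowBoundary_eq_empty_of_isOpenMap {Φ : Flow ℝ X} {S : Set X}
    {η : ℝ} (hη : 0 < η) (hS : IsClosed S)
    (hopen : IsOpenMap (fun p : S × ℝ => Φ p.2 (p.1 : X))) : flowBoundary Φ S η = ∅ := by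
  rw [flowBoundary, sdiff_eq_empty, hS.closure_eq]
  intro x hx
  refine ⟨interior_maximal (flow_image_subset_cyl Φ S η) (isOpen_flow_image hopen η) ?_, hx⟩
  exact ⟨(⟨x, hx⟩, 0), ⟨mem_univ _, by simp only; linarith, hη⟩, Φ.map_zero_apply x⟩

theorem isGlobal_of_isOpenMap [CompactSpace X] {Φ : Flow ℝ X}
    {S : Set X} (hsurj : Function.Surjective (fun p : S × ℝ => Φ p.2 (p.1 : X)))
    (hopen : IsOpenMap (fun p : S × ℝ => Φ p.2 (p.1 : X))) : IsGlobal Φ S := by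
  let U : ℕ → Set X := fun n =>
    (fun p : S × ℝ => Φ p.2 (p.1 : X)) '' (univ ×ˢ Ioo (-((n : ℝ) + 1)) (n + 1))
  have hcover : (univ : Set X) ⊆ ⋃ n, U n := by
    intro x _
    obtain ⟨⟨a, t⟩, rfl⟩ := hsurj x
    obtain ⟨n, hn⟩ := exists_nat_gt |t|
    exact mem_iUnion.mpr ⟨n, (a, t), ⟨mem_univ _, abs_lt.mp (by simp only; linarith)⟩, rfl⟩
  have hmono : Monotone U := fun m n hmn => by
    have : (m : ℝ) ≤ n := by exact_mod_cast hmn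
    exact image_mono (prod_mono subset_rfl (Ioo_subset_Ioo (by linarith) (by linarith)))
  obtain ⟨n, hn⟩ := isCompact_univ.elim_directed_cover U
    (fun n => isOpen_flow_image hopen _) hcover hmono.directed_le
  exact ⟨n + 1, by positivity, univ_subset_iff.mp (hn.trans (flow_image_subset_cyl Φ S _))⟩

theorem IsGlobal.surjective_flowMap {Φ : Flow ℝ X} {S : Set X}
    (h : IsGlobal Φ S) : Function.Surjective (fun p : S × ℝ => Φ p.2 (p.1 : X)) := by
  obtain ⟨ξ, -, hξ⟩ := h
  intro x
  obtain ⟨t, -, a, ha, rfl⟩ := mem_cyl_iff.mp (hξ ▸ mem_univ x)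
  exact ⟨(⟨a, ha⟩, t), rfl⟩

/-- `S` is a Poincaré cross-section (closed cross-section such that the flow map
`S × ℝ → X` is a surjective local homeomorphism) iff `S` is a global closed cross-section with
empty flow boundary. -/
theorem poincare_crossSection_iff {X : Type*} [MetricSpace X] [CompactSpace X]
    (Φ : Flow ℝ X) (hreg : Regular Φ) (S : Set X) :
    (IsClosed S ∧ (∃ η > 0, IsCrossSection Φ S η) ∧
      Function.Surjective (fun p : S × ℝ => Φ p.2 (p.1 : X)) ∧
      IsLocalHomeomorph (fun p : S × ℝ => Φ p.2 (p.1 : X))) ↔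
    (IsClosed S ∧ (∃ η > 0, IsCrossSection Φ S η ∧ flowBoundary Φ S η = ∅) ∧ IsGlobal Φ S) := by
  constructor
  · rintro ⟨hS, ⟨η, hη, hcs⟩, hsurj, hloc⟩
    exact ⟨hS, ⟨η, hη, hcs, flowBoundary_eq_empty_of_isOpenMap hη hS hloc.isOpenMap⟩,
      isGlobal_of_isOpenMap hsurj hloc.isOpenMap⟩
  · rintro ⟨hS, ⟨η, hη, hcs, hbd⟩, hglob⟩
    refine ⟨hS, ⟨η, hη, hcs⟩, hglob.surjective_flowMap,
      hcs.isLocalHomeomorph_flowMap hη (isOpenMap_flowMap fun s =>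
        nhds_le_map_flowMap_zero hη hS hcs s ?_)⟩
    rw [flowBoundary, sdiff_eq_empty] at hbd
    exact mem_interior_iff_mem_nhds.mp (hbd (subset_closure s.2)).1

end FlowPaper
end

section
/- Let (X,Φ) be a regular topological flow, let S be a closed cross-section of time η > 0, and let t ≠ 0. The following properties are equivalent: (i) μ(∂^Φ S_η) = 0 for every Φ-invariant Borel probability measure μ (i.e., S has a small flow boundary for the flow Φ); (ii) μ(∂^Φ S_η) = 0 for every Borel probability measure μ on X invariant under the time t-map φ_t. -/
open Set Filter Topology MeasureTheory

namespace FlowPaper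

variable {X : Type*} [MetricSpace X]

/-- The average `∫₀¹ (φ_{ut})_* μ du` of a measure along an orbit segment of length `t`. -/
noncomputable def flowAverage [MeasurableSpace X] (Φ : Flow ℝ X) (t : ℝ) (μ : Measure X) :
    Measure X :=
  Measure.map (fun p : ℝ × X => Φ (p.1 * t) p.2) ((volume.restrict (Ioc (0 : ℝ) 1)).prod μ)

lemma setLIntegral_Ioc_add_of_periodic {g : ℝ → ENNReal} (hg : Function.Periodic g 1) (c : ℝ) :
    ∫⁻ u in Ioc (0 : ℝ) 1, g (u + c) = ∫⁻ u in Ioc (0 : ℝ) 1, g u := by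
  have h1 : ∫⁻ u in Ioc (0 : ℝ) 1, g (u + c) = ∫⁻ u in Ioc c (c + 1), g u := by
    have h := (measurePreserving_add_right volume c).setLIntegral_comp_preimage_emb
      (measurableEmbedding_addRight c) g (Ioc c (c + 1))
    rw [← h]
    simp
  have h2 := (isAddFundamentalDomain_Ioc one_pos c volume).setLIntegral_eq
    (isAddFundamentalDomain_Ioc one_pos 0 volume) g (by
      rintro ⟨_, n, rfl⟩ x
      have := hg.zsmul n x
      simpa [AddSubgroup.vadd_def, add_comm] using this)
  rw [h1, h2, zero_add]

lemma measurable_flow [MeasurableSpace X] [BorelSpace X] (Φ : Flow ℝ X) (s : ℝ) :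
    Measurable (Φ s) :=
  (Φ.continuous continuous_const continuous_id).measurable

section FlowAverage

variable [CompactSpace X] [MeasurableSpace X] [BorelSpace X]

lemma measurable_flow_mul (Φ : Flow ℝ X) (t : ℝ) :
    Measurable (fun p : ℝ × X => Φ (p.1 * t) p.2) :=
  (Φ.continuous (continuous_fst.mul continuous_const) continuous_snd).measurable

lemma flowAverage_apply (Φ : Flow ℝ X) (t : ℝ) (μ : Measure X) [SFinite μ] {A : Set X}
    (hA : MeasurableSet A) :
    flowAverage Φ t μ A = ∫⁻ u in Ioc (0 : ℝ) 1, μ (Φ (u * t) ⁻¹' A) := by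
  rw [flowAverage, Measure.map_apply (measurable_flow_mul Φ t) hA,
    Measure.prod_apply (measurable_flow_mul Φ t hA)]
  rfl

lemma isProbabilityMeasure_flowAverage (Φ : Flow ℝ X) (t : ℝ) (μ : Measure X)
    [IsProbabilityMeasure μ] : IsProbabilityMeasure (flowAverage Φ t μ) :=
  ⟨by simp [flowAverage_apply Φ t μ MeasurableSet.univ]⟩

lemma flowInvariant_flowAverage (Φ : Flow ℝ X) {t : ℝ} (ht : t ≠ 0) (μ : Measure X) [SFinite μ]
    (hμ : Measure.map (Φ t) μ = μ) : FlowInvariant Φ (flowAverage Φ t μ) := by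
  intro s
  ext A hA
  have hper : Function.Periodic (fun u : ℝ => μ (Φ (u * t) ⁻¹' A)) 1 := by
    intro u
    change μ (Φ ((u + 1) * t) ⁻¹' A) = μ (Φ (u * t) ⁻¹' A)
    conv_rhs => rw [← hμ, Measure.map_apply (measurable_flow Φ t) (measurable_flow Φ _ hA)]
    congr 1
    ext x
    simp only [mem_preimage, ← Φ.map_add, add_mul, one_mul]
  rw [Measure.map_apply (measurable_flow Φ s) hA, flowAverage_apply Φ t μ hA,
    flowAverage_apply Φ t μ (measurable_flow Φ s hA),
    ← setLIntegral_Ioc_add_of_periodic hper (s / t)]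
  congr 1 with u
  congr 1
  ext x
  simp only [mem_preimage, ← Φ.map_add]
  rw [add_mul, div_mul_cancel₀ _ ht, add_comm]

lemma flowAverage_apply_of_invariant (Φ : Flow ℝ X) (t : ℝ) (μ : Measure X) [SFinite μ]
    {U : Set X} (hU : MeasurableSet U) (hinv : ∀ s, Φ s ⁻¹' U = U) :
    flowAverage Φ t μ U = μ U := by
  simp [flowAverage_apply Φ t μ hU, hinv]

end FlowAverage

lemma isCompact_cyl (Φ : Flow ℝ X) {B : Set X} (hB : IsCompact B) (ζ : ℝ) :
    IsCompact (cyl Φ B ζ) := by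
  have h : cyl Φ B ζ = (fun p : ℝ × X => Φ p.1 p.2) '' (Icc (-ζ) ζ ×ˢ B) := by
    ext x
    simp only [cyl, flowSet, mem_iUnion, mem_image, mem_prod, Prod.exists]
    grind
  rw [h]
  exact (isCompact_Icc.prod hB).image (Φ.continuous continuous_fst continuous_snd)

lemma isClosed_flowBoundary (Φ : Flow ℝ X) {S : Set X} (hS : IsClosed S) (η : ℝ) :
    IsClosed (flowBoundary Φ S η) := by
  have h : flowBoundary Φ S η = S ∩ (interior (cyl Φ S η))ᶜ := by
    ext x
    simp only [flowBoundary, flowInterior, hS.closure_eq, Set.mem_sdiff, mem_inter_iff, mem_compl_iff]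
    tauto
  rw [h]
  exact hS.inter isOpen_interior.isClosed_compl

/-- The orbit of a cylinder of positive height, written as a countable union of translates of
the cylinder, is invariant under the flow. -/
lemma preimage_iUnion_preimage_cyl (Φ : Flow ℝ X) (B : Set X) {ζ : ℝ} (hζ : 0 < ζ) (s : ℝ) :
    Φ s ⁻¹' (⋃ n : ℤ, Φ (n * ζ) ⁻¹' cyl Φ B ζ) = ⋃ n : ℤ, Φ (n * ζ) ⁻¹' cyl Φ B ζ := by
  have key : ∀ x, x ∈ (⋃ n : ℤ, Φ (n * ζ) ⁻¹' cyl Φ B ζ) ↔ ∃ r : ℝ, Φ r x ∈ B := by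
    intro x
    simp only [cyl, flowSet, mem_iUnion, mem_preimage, mem_image]
    constructor
    · rintro ⟨n, r, -, b, hb, hbx⟩
      refine ⟨-r + n * ζ, ?_⟩
      rw [Φ.map_add, ← hbx, ← Φ.map_add, neg_add_cancel, Φ.map_zero_apply]
      exact hb
    · rintro ⟨r, hr⟩
      have h1 : ⌊r / ζ⌋ * ζ ≤ r := (le_div_iff₀ hζ).1 (Int.floor_le _)
      have h2 : r < (⌊r / ζ⌋ + 1) * ζ := (div_lt_iff₀ hζ).1 (Int.lt_floor_add_one _)
      refine ⟨⌊r / ζ⌋, ⌊r / ζ⌋ * ζ - r, ⟨by linarith, by linarith⟩, Φ r x, hr, ?_⟩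
      rw [← Φ.map_add, sub_add_cancel]
  ext x
  rw [mem_preimage, key, key]
  constructor
  · rintro ⟨r, hr⟩
    exact ⟨r + s, by rwa [Φ.map_add]⟩
  · rintro ⟨r, hr⟩
    exact ⟨r - s, by rwa [← Φ.map_add, sub_add_cancel]⟩

/-- for a closed cross-section and `t ≠ 0`, the flow boundary cylinder is null
for all `Φ`-invariant measures iff it is null for all `φ_t`-invariant measures. -/
theorem smallFlowBoundary_iff_timeT {X : Type*} [MetricSpace X] [CompactSpace X]
    [MeasurableSpace X] [BorelSpace X]
    (Φ : Flow ℝ X) (hreg : Regular Φ) (S : Set X) (η : ℝ) (hη : 0 < η)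
    (hcl : IsClosed S) (hS : IsCrossSection Φ S η) (t : ℝ) (ht : t ≠ 0) :
    (∀ μ : Measure X, IsProbabilityMeasure μ → FlowInvariant Φ μ →
      μ (flowBoundaryCyl Φ S η η) = 0) ↔
    (∀ μ : Measure X, IsProbabilityMeasure μ → Measure.map (Φ t) μ = μ →
      μ (flowBoundaryCyl Φ S η η) = 0) := by
  constructor
  · intro h μ hp hμ
    set F := flowBoundaryCyl Φ S η η
    have hFm : MeasurableSet F :=
      (isCompact_cyl Φ (isClosed_flowBoundary Φ hcl η).isCompact η).isClosed.measurableSet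
    set U : Set X := ⋃ n : ℤ, Φ (n * η) ⁻¹' F
    have hUm : MeasurableSet U := .iUnion fun n => measurable_flow Φ _ hFm
    have hFU : F ⊆ U := fun x hx => mem_iUnion.2 ⟨0, by simpa using hx⟩
    have hinv := flowInvariant_flowAverage Φ ht μ hμ
    have hνF := h _ (isProbabilityMeasure_flowAverage Φ t μ) hinv
    have hνU : flowAverage Φ t μ U = 0 := measure_iUnion_null fun n => by
      rw [← Measure.map_apply (measurable_flow Φ _) hFm, hinv, hνF]
    rw [flowAverage_apply_of_invariant Φ t μ hUm
      (preimage_iUnion_preimage_cyl Φ (flowBoundary Φ S η) hη)] at hνU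
    exact measure_mono_null hFU hνU
  · exact fun h μ hp hμ => h μ hp (hμ t)

end FlowPaper
end
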